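/- Let G be a finite insoluble group. Then for every element x ∈ G, the cardinality of Sol_G(x) is not equal to 8. -/

import Mathlib

/-- The solubilizer of an element `x` of a group `G`: the set of all `y ∈ G`
such that the subgroup generated by `x` and `y` is soluble. -/
def solubilizer {G : Type*} [Group G] (x : G) : Set G :=
  {y | IsSolvable ↥(Subgroup.closure ({x, y} : Set G))}

section

open Subgroup

theorem isSolvable_sup_of_le_normalizer {G : Type*} [Group G] (S T : Subgroup G)
    [Group.IsSolvable S] [Group.IsSolvable T] (h : T ≤ normalizer (S : Set G)) :
    Group.IsSolvable ↥(T ⊔ S) := by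
  have := normal_subgroupOf_sup_of_le_normalizer h
  have := normal_subgroupOf_of_le_normalizer h
  rw [Group.isSolvable_iff_subgroup_quotient (S.subgroupOf (T ⊔ S))]
  refine ⟨Group.isSolvable_of_isSolvable_injective
    (subgroupOfEquivOfLe (le_sup_right : S ≤ T ⊔ S)).injective
    (f := (subgroupOfEquivOfLe (le_sup_right : S ≤ T ⊔ S)).toMonoidHom), ?_⟩
  exact Group.isSolvable_of_surjective
    (f := (QuotientGroup.quotientInfEquivProdNormalizerQuotient T S h).toMonoidHom)
    (QuotientGroup.quotientInfEquivProdNormalizerQuotient T S h).surjective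

theorem isSolvable_of_le {G : Type*} [Group G] {S T : Subgroup G} (h : S ≤ T) [Group.IsSolvable T] :
    Group.IsSolvable S :=
  Group.isSolvable_of_isSolvable_injective (inclusion_injective h)

instance isSolvable_zpowers {G : Type*} [Group G] (g : G) : Group.IsSolvable (zpowers g) :=
  Group.isSolvable_of_comm mul_comm'

theorem isSolvable_zpowers_sup {G : Type*} [Group G] (S : Subgroup G) [Group.IsSolvable S] {g : G}
    (h : g ∈ normalizer (S : Set G)) : Group.IsSolvable ↥(zpowers g ⊔ S) :=
  isSolvable_sup_of_le_normalizer S _ (by simpa using h)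

theorem mem_solubilizer_of_mem {G : Type*} [Group G] {x y : G} (S : Subgroup G) [Group.IsSolvable S]
    (hx : x ∈ S) (hy : y ∈ S) : y ∈ solubilizer x :=
  isSolvable_of_le (T := S) (by simp [Set.insert_subset_iff, hx, hy])

theorem mem_normalizer_of_conj_mem {G : Type*} [Group G] [Finite G] {S : Subgroup G} {g : G}
    (h : ∀ s ∈ S, g * s * g⁻¹ ∈ S) : g ∈ normalizer (S : Set G) := by
  rw [mem_normalizer_iff_map_conj_eq]
  apply eq_of_le_of_card_ge
  · rintro _ ⟨s, hs, rfl⟩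
    exact h s hs
  · exact (Nat.card_congr (S.equivMapOfInjective _ (MulAut.conj g).injective).toEquiv).le

/-- The image of `⟨x, y⟩` modulo `S` is generated by two involutions. -/
theorem mem_solubilizer_of_sq_mem {G : Type*} [Group G] [Finite G] (S : Subgroup G)
    [Group.IsSolvable S] {x y : G} (hx : x ∈ normalizer (S : Set G)) (hy : y ∈ normalizer (S : Set G))
    (hx2 : x ^ 2 ∈ S) (hy2 : y ^ 2 ∈ S) : y ∈ solubilizer x := by
  have hr := mul_mem hx hy
  have := isSolvable_zpowers_sup S hr
  have hS : S ≤ zpowers (x * y) ⊔ S := le_sup_right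
  have hxy : x * y ∈ zpowers (x * y) ⊔ S := le_sup_left (a := zpowers (x * y)) (mem_zpowers _)
  have hxT : x ∈ normalizer ((zpowers (x * y) ⊔ S : Subgroup G) : Set G) := by
    apply mem_normalizer_of_conj_mem
    suffices h : zpowers (x * y) ⊔ S ≤ (zpowers (x * y) ⊔ S).comap (MulAut.conj x).toMonoidHom from
      fun s hs ↦ h hs
    refine sup_le (zpowers_le.2 ?_) fun s hs ↦ hS ((mem_normalizer_iff.1 hx s).1 hs)
    have h : x * (x * y) * x⁻¹ = x ^ 2 * y ^ 2 * (x * y)⁻¹ := by simp [pow_two, mul_assoc]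
    change x * (x * y) * x⁻¹ ∈ zpowers (x * y) ⊔ S
    rw [h]
    exact mul_mem (mul_mem (hS hx2) (hS hy2)) (inv_mem hxy)
  have := isSolvable_zpowers_sup _ hxT
  have hxm : x ∈ zpowers x ⊔ (zpowers (x * y) ⊔ S) :=
    le_sup_left (a := zpowers x) (mem_zpowers _)
  refine mem_solubilizer_of_mem _ hxm ?_
  have := mul_mem (inv_mem hxm) (le_sup_right (a := zpowers x) hxy)
  simpa using this

theorem card_le_card_solubilizer {G : Type*} [Group G] [Finite G] {x : G} (S : Subgroup G)
    [Group.IsSolvable S] (hx : x ∈ S) : Nat.card S ≤ Nat.card (solubilizer x) :=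
  Nat.card_mono (Set.toFinite _) fun _ hy ↦ mem_solubilizer_of_mem S hx hy

theorem orderOf_dvd_card_solubilizer {G : Type*} [Group G] (x : G) :
    orderOf x ∣ Nat.card (solubilizer x) := by
  have h : solubilizer x = QuotientGroup.mk (s := zpowers x) ⁻¹'
      (QuotientGroup.mk '' solubilizer x) := by
    refine (Set.subset_preimage_image _ _).antisymm ?_
    rintro y ⟨w, hw, hwy⟩
    obtain ⟨k, hk⟩ := mem_zpowers_iff.1 (QuotientGroup.eq.1 hwy)
    obtain rfl : y = w * x ^ k := by simp [hk]
    have : Group.IsSolvable (closure {x, w}) := hw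
    have hx : x ∈ closure {x, w} := subset_closure (by simp)
    exact mem_solubilizer_of_mem (closure {x, w}) hx
      (mul_mem (subset_closure (by simp)) (zpow_mem hx k))
  rw [h, QuotientGroup.card_preimage_mk, Nat.card_zpowers]
  exact dvd_mul_right _ _

/-- A `2`-element stabilizes a Sylow `p`-subgroup of each normal subgroup of odd order. -/
theorem exists_sylow_normalized {G : Type*} [Group G] [Finite G] {x : G} {n : ℕ}
    (hx : orderOf x = 2 ^ n) (N : Subgroup G) [N.Normal] (hN : Odd (Nat.card N))
    (p : ℕ) [Fact p.Prime] (hp : p ∣ Nat.card N) :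
    ∃ T ≤ N, IsPGroup p T ∧ p ∣ Nat.card T ∧ x ∈ normalizer (T : Set G) := by
  obtain ⟨S⟩ : Nonempty (Sylow p N) := inferInstance
  have htop := S.normalizer_sup_eq_top
  set R := (S : Subgroup N).map N.subtype with hR
  set M := normalizer (R : Set G) with hM
  have hodd : ¬ 2 ∣ Nat.card (G ⧸ M) := by
    have h1 : N.relIndex M = N.index := by
      rw [← relIndex_sup_right M N, htop, relIndex_top_right]
    have h2 := N.card_mul_index
    have h3 := M.card_mul_index
    have h4 : _ * N.relIndex M = _ := (N.subgroupOf M).card_mul_index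
    have h5 : Nat.card N = Nat.card (N.subgroupOf M) * M.index := by
      apply Nat.eq_of_mul_eq_mul_right (Nat.pos_of_ne_zero N.index_ne_zero_of_finite)
      rw [h2, ← h3, ← h4, h1]
      ring
    intro h
    exact hN.not_two_dvd_nat (h.trans ⟨_, h5.trans (mul_comm _ _)⟩)
  have hpg : IsPGroup 2 (zpowers x) := IsPGroup.of_card (n := n) (by rw [Nat.card_zpowers, hx])
  obtain ⟨q, hq⟩ := hpg.nonempty_fixed_point_of_prime_not_dvd_card (G ⧸ M) hodd
  obtain ⟨g, rfl⟩ := QuotientGroup.mk_surjective q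
  have hg : g⁻¹ * x * g ∈ M := by
    have := hq ⟨x⁻¹, by simp⟩
    have := QuotientGroup.eq.1 this
    simpa [mul_assoc] using this
  refine ⟨R.map (MulAut.conj g).toMonoidHom, ?_, ?_, ?_, ?_⟩
  · rintro _ ⟨_, ⟨s, -, rfl⟩, rfl⟩
    exact Normal.conj_mem ‹_› _ s.2 g
  · exact (S.2.map _).map _
  · rw [← Nat.card_congr (R.equivMapOfInjective _ (MulAut.conj g).injective).toEquiv, hR,
      ← Nat.card_congr ((S : Subgroup N).equivMapOfInjective _ N.subtype_injective).toEquiv]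
    exact S.dvd_card_of_dvd_card hp
  · apply mem_normalizer_of_conj_mem
    rintro _ ⟨s, hs, rfl⟩
    refine ⟨_, (mem_normalizer_iff.1 hg s).1 hs, ?_⟩
    simp [mul_assoc]

theorem isSolvable_of_odd_normal {G : Type*} [Group G] [Finite G] {x : G} {n : ℕ}
    (hx : orderOf x = 2 ^ n) (hx1 : x ≠ 1) (hcard : Nat.card (solubilizer x) = 8)
    (N : Subgroup G) [N.Normal] (hN : Odd (Nat.card N)) : Group.IsSolvable N := by
  have h3 (p : ℕ) (hp : p.Prime) (hpN : p ∣ Nat.card N) : p = 3 := by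
    have := Fact.mk hp
    obtain ⟨T, hTN, hT, hpT, hxT⟩ := exists_sylow_normalized hx N hN p hpN
    have : Group.IsNilpotent T := hT.isNilpotent
    have := isSolvable_zpowers_sup T hxT
    have hle := card_le_card_solubilizer (x := x) (zpowers x ⊔ T)
      (le_sup_left (a := zpowers x) (mem_zpowers _))
    have hTodd : Odd (Nat.card T) := hN.of_dvd_nat (card_dvd_of_le hTN)
    have hdvd : Nat.card (zpowers x) * Nat.card T ∣ Nat.card ↥(zpowers x ⊔ T) := by
      apply Nat.Coprime.mul_dvd_of_dvd_of_dvd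
      · rw [Nat.card_zpowers, hx]
        exact (Nat.coprime_two_left.2 hTodd).pow_left n
      · exact card_dvd_of_le le_sup_left
      · exact card_dvd_of_le le_sup_right
    have h2 : 2 ≤ orderOf x := by
      have := orderOf_pos x
      have := mt orderOf_eq_one_iff.1 hx1
      omega
    have h8 := (Nat.le_of_dvd Nat.card_pos hdvd).trans hle
    rw [hcard, Nat.card_zpowers] at h8
    have h4 : Nat.card T ≤ 4 := by nlinarith
    have hpodd : Odd p := hN.of_dvd_nat hpN
    have hp4 : p ≤ 4 := (Nat.le_of_dvd Nat.card_pos hpT).trans h4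
    have := hp.two_le
    obtain ⟨k, rfl⟩ := hpodd
    omega
  have := Fact.mk Nat.prime_three
  have : IsPGroup 3 N := by
    rw [IsPGroup.iff_card]
    exact ⟨_, Nat.eq_prime_pow_of_unique_prime_dvd Nat.card_pos.ne' (h3 _)⟩
  have := this.isNilpotent
  infer_instance

/-- If a Sylow `2`-subgroup is central in its normalizer, then Burnside's theorem applies. -/
theorem isSolvable_of_normalizer_le_centralizer {G : Type*} [Group G] [Finite G] {x : G} {n : ℕ}
    (hx : orderOf x = 2 ^ n) (hx1 : x ≠ 1) (hcard : Nat.card (solubilizer x) = 8)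
    {K : Type*} [Group K] (ι : K →* G) (hι : Function.Injective ι) [ι.range.Normal] (P : Sylow 2 K)
    (hP : normalizer (P : Set K) ≤ centralizer (P : Set K)) : Group.IsSolvable K := by
  have := Finite.of_injective ι hι
  set f := MonoidHom.transferSylow P hP
  have hodd : Odd (Nat.card f.ker) := by
    rw [← Nat.not_even_iff_odd, even_iff_two_dvd]
    exact MonoidHom.not_dvd_card_ker_transferSylow P hP
  have hcardmap : Nat.card (f.ker.map ι) = Nat.card f.ker :=
    (Nat.card_congr (f.ker.equivMapOfInjective _ hι).toEquiv).symm
  have hnorm : (f.ker.map ι).Normal := by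
    refine ⟨?_⟩
    rintro _ ⟨k, hk, rfl⟩ g
    obtain ⟨k', hk'⟩ := Normal.conj_mem (H := ι.range) ‹_› _ ⟨k, rfl⟩ g
    refine ⟨k', ?_, hk'⟩
    have h1 : k ^ Nat.card f.ker = 1 := by
      have := pow_card_eq_one' (x := (⟨k, hk⟩ : f.ker))
      simpa using congrArg Subtype.val this
    have h2 : k' ^ Nat.card f.ker = 1 := by
      apply hι
      rw [map_pow, hk', conj_pow, ← map_pow, h1]
      simp
    have h3 : f k' ^ Nat.card f.ker = 1 := by rw [← map_pow, h2, map_one]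
    have h4 := orderOf_dvd_of_pow_eq_one h3
    obtain ⟨m, hm⟩ := (IsPGroup.iff_orderOf.1 P.2) (f k')
    have h5 : orderOf (f k') = 1 := by
      exact Nat.eq_one_of_dvd_coprimes ((Nat.coprime_two_left.2 hodd).pow_left m) hm.dvd h4
    exact orderOf_eq_one_iff.1 h5
  have := isSolvable_of_odd_normal hx hx1 hcard (f.ker.map ι) (hcardmap ▸ hodd)
  have : Group.IsSolvable f.ker := Group.isSolvable_of_isSolvable_injective
    (f := (f.ker.equivMapOfInjective _ hι).toMonoidHom)
    (f.ker.equivMapOfInjective _ hι).injective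
  have := P.2.isNilpotent
  exact Group.isSolvable_of_ker_le_range f.ker.subtype f (by simp)

theorem relations_of_card_eq_eight {Q : Type*} [Group Q] (hQ : Nat.card Q = 8)
    (hcomm : ¬ ∀ a b : Q, a * b = b * a) {x : Q} (hx : orderOf x = 4) :
    (∀ a : Q, a * x ^ 2 = x ^ 2 * a) ∧ (∀ a : Q, a ^ 2 = 1 ∨ a ^ 2 = x ^ 2) ∧
    (∀ a b : Q, a * b * a⁻¹ * b⁻¹ = 1 ∨ a * b * a⁻¹ * b⁻¹ = x ^ 2) ∧
    (∀ a b : Q, a ∉ zpowers x → b ∉ zpowers x → a * b ∈ zpowers x) := by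
  have : Finite Q := Nat.finite_of_card_ne_zero (by simp [hQ])
  have hindex : (zpowers x).index = 2 := by
    have := (zpowers x).card_mul_index
    rw [Nat.card_zpowers, hx, hQ] at this
    omega
  have hx4 : (x ^ 2) ^ 2 = 1 := by
    rw [← pow_mul]
    exact orderOf_dvd_iff_pow_eq_one.1 hx.dvd
  have hx2 : x ^ 2 ≠ 1 := fun h ↦ by
    have := Nat.le_of_dvd (by norm_num) (orderOf_dvd_of_pow_eq_one h)
    omega
  have hnormal := normal_of_index_eq_two hindex
  have hzpow (k : ℤ) : (x ^ 2) ^ k = 1 ∨ (x ^ 2) ^ k = x ^ 2 := by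
    rcases Int.even_or_odd' k with ⟨m, rfl | rfl⟩
    · left
      rw [zpow_mul]
      norm_cast
      rw [hx4, one_zpow]
    · right
      rw [zpow_add, zpow_mul]
      norm_cast
      rw [hx4, one_zpow, one_mul, pow_one]
  have hcent (a : Q) : a * x ^ 2 = x ^ 2 * a := by
    obtain ⟨k, hk⟩ := mem_zpowers_iff.1 (hnormal.conj_mem x (mem_zpowers x) a)
    have h : a * x ^ 2 * a⁻¹ = (x ^ 2) ^ k := by
      rw [← conj_pow, ← hk, ← zpow_natCast, ← zpow_natCast, ← zpow_mul, ← zpow_mul, mul_comm]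
    rcases hzpow k with h' | h'
    · rw [h', conj_eq_one_iff] at h
      exact absurd h hx2
    · rw [h'] at h
      exact mul_inv_eq_iff_eq_mul.1 h
  refine ⟨hcent, fun a ↦ ?_, fun a b ↦ ?_, fun a b ha hb ↦ ?_⟩
  · have h8 : orderOf a ≠ 8 := fun h ↦ hcomm fun c d ↦ by
      have := isCyclic_of_orderOf_eq_card a (h.trans hQ.symm)
      have := IsCyclic.isMulCommutative (α := Q)
      exact mul_comm' c d
    have h4 : a ^ 4 = 1 := by
      have hdvd : orderOf a ∣ 2 ^ 3 := by simpa [hQ] using orderOf_dvd_natCard a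
      obtain ⟨k, hk, hak⟩ := (Nat.dvd_prime_pow Nat.prime_two).1 hdvd
      apply orderOf_dvd_iff_pow_eq_one.1
      interval_cases k <;> simp_all
    obtain ⟨k, hk⟩ := mem_zpowers_iff.1 (sq_mem_of_index_two hindex a)
    have h : (x ^ 2) ^ k = 1 := by
      rw [← zpow_natCast, ← zpow_mul, mul_comm, zpow_mul, hk]
      exact_mod_cast (pow_mul a 2 2).symm.trans h4
    rcases Int.even_or_odd' k with ⟨m, rfl | rfl⟩
    · rw [← hk, zpow_mul]
      exact_mod_cast hzpow m
    · rw [zpow_add, zpow_mul] at h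
      norm_cast at h
      simp [hx4, hx2] at h
  · have hn : (zpowers (x ^ 2)).Normal := by
      refine ⟨fun n hn g ↦ ?_⟩
      obtain ⟨k, rfl⟩ := mem_zpowers_iff.1 hn
      have hg : Commute g (x ^ 2) := hcent g
      rw [(hg.zpow_right k).eq, mul_inv_cancel_right]
      exact hn
    have hcard : Nat.card (Q ⧸ zpowers (x ^ 2)) = 2 ^ 2 := by
      have h1 := (zpowers (x ^ 2)).card_mul_index
      have h2 : orderOf (x ^ 2) = 2 := orderOf_eq_prime hx4 hx2
      rw [Nat.card_zpowers, h2, hQ] at h1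
      change (zpowers (x ^ 2)).index = _
      omega
    have := IsPGroup.isMulCommutative_of_card_eq_prime_sq hcard
    have hab := mul_comm' (a : Q ⧸ zpowers (x ^ 2)) (b : Q ⧸ zpowers (x ^ 2))
    have hmem : a * b * a⁻¹ * b⁻¹ ∈ zpowers (x ^ 2) := by
      rw [← QuotientGroup.eq_one_iff]
      simp only [QuotientGroup.mk_mul, QuotientGroup.mk_inv, hab]
      group
    obtain ⟨k, hk⟩ := mem_zpowers_iff.1 hmem
    rw [← hk]
    exact hzpow k
  · rw [mul_mem_iff_of_index_two hindex]
    simp [ha, hb]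

theorem mem_of_commute_sq {G : Type*} [Group G] [Finite G] {x : G} {P : Subgroup G}
    [Group.IsSolvable P] (hP : solubilizer x ⊆ P) {g : G}
    (hg : Commute g (x ^ 2)) : g ∈ P := by
  set C := centralizer {x ^ 2} with hC
  have hgC {g : G} : g ∈ C ↔ Commute g (x ^ 2) := mem_centralizer_singleton_iff
  have hnorm {y : G} (hy : Commute y (x ^ 2)) : y ∈ normalizer (zpowers (x ^ 2) : Set G) := by
    apply mem_normalizer_of_conj_mem
    intro s hs
    obtain ⟨k, rfl⟩ := mem_zpowers_iff.1 hs
    rw [(hy.zpow_right k).eq, mul_inv_cancel_right]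
    exact hs
  have hconj {g : G} (hg : g ∈ C) : g * x * g⁻¹ ∈ P := by
    have hsq : (g * x * g⁻¹) ^ 2 = x ^ 2 := by
      rw [conj_pow, (hgC.1 hg).eq, mul_inv_cancel_right]
    refine hP (mem_solubilizer_of_sq_mem (zpowers (x ^ 2)) (hnorm ?_) (hnorm ?_) (mem_zpowers _) ?_)
    · exact Commute.self_pow x 2
    · rw [← hsq]
      exact Commute.self_pow _ 2
    · rw [hsq]
      exact mem_zpowers _
  set K := closure ((fun g ↦ g * x * g⁻¹) '' (C : Set G)) with hK
  have hKP : K ≤ P := by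
    rw [hK, closure_le]
    rintro _ ⟨g, hg, rfl⟩
    exact hconj hg
  have hxK : x ∈ K := subset_closure ⟨1, one_mem C, by simp⟩
  have hgK : g ∈ normalizer (K : Set G) := by
    apply mem_normalizer_of_conj_mem
    suffices h : K ≤ K.comap (MulAut.conj g).toMonoidHom from fun s hs ↦ h hs
    rw [hK, closure_le]
    rintro _ ⟨h, hh, rfl⟩
    exact subset_closure ⟨g * h, mul_mem (hgC.2 hg) hh, by simp [mul_assoc]⟩
  have := isSolvable_of_le hKP
  have := isSolvable_zpowers_sup K hgK
  exact hP (mem_solubilizer_of_mem (zpowers g ⊔ K) (le_sup_right (a := zpowers g) hxK)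
    (le_sup_left (a := zpowers g) (mem_zpowers g)))

section WeakClosure

variable {G : Type*} [Group G] {x : G} {P : Subgroup G}

theorem conj_sq_eq_of_mem [Finite G] (hxP : x ∈ P) (hP : solubilizer x ⊆ P)
    (hC : ∀ g, Commute g (x ^ 2) → g ∈ P) (hx2 : x ^ 2 ≠ 1)
    (hcent : ∀ a ∈ P, a * x ^ 2 = x ^ 2 * a) (hsq : ∀ a ∈ P, a ^ 2 = 1 ∨ a ^ 2 = x ^ 2)
    (hcomm : ∀ a ∈ P, ∀ b ∈ P, a * b * a⁻¹ * b⁻¹ = 1 ∨ a * b * a⁻¹ * b⁻¹ = x ^ 2)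
    {g : G} (hg : g * x ^ 2 * g⁻¹ ∈ P) : g * x ^ 2 * g⁻¹ = x ^ 2 := by
  set z := x ^ 2 with hz
  set u := g * z * g⁻¹ with hu
  set y := g * x * g⁻¹ with hy
  have hyu : y ^ 2 = u := by rw [hy, conj_pow]
  have huz : Commute u z := hcent u hg
  have hzz : u ∈ normalizer (zpowers z : Set G) := by
    apply mem_normalizer_of_conj_mem
    intro s hs
    obtain ⟨k, rfl⟩ := mem_zpowers_iff.1 hs
    rw [(huz.zpow_right k).eq, mul_inv_cancel_right]
    exact hs
  have hS := isSolvable_zpowers_sup _ hzz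
  have hzS : z ∈ zpowers u ⊔ zpowers z := le_sup_right (a := zpowers u) (mem_zpowers z)
  have huS : u ∈ zpowers u ⊔ zpowers z := le_sup_left (a := zpowers u) (mem_zpowers u)
  have hnorm {w : G} (h1 : w * z * w⁻¹ ∈ zpowers u ⊔ zpowers z)
      (h2 : w * u * w⁻¹ ∈ zpowers u ⊔ zpowers z) :
      w ∈ normalizer ((zpowers u ⊔ zpowers z : Subgroup G) : Set G) := by
    apply mem_normalizer_of_conj_mem
    suffices h : zpowers u ⊔ zpowers z ≤
      (zpowers u ⊔ zpowers z).comap (MulAut.conj w).toMonoidHom from fun s hs ↦ h hs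
    exact sup_le (zpowers_le.2 h2) (zpowers_le.2 h1)
  have hwP : g⁻¹ * z * g ∈ P := by
    apply hC
    have := congrArg (fun t ↦ g⁻¹ * t * g) huz.eq
    simp only [hu] at this
    simpa [Commute, SemiconjBy, mul_assoc] using this.symm
  have hyP : y ∈ P := by
    refine hP (mem_solubilizer_of_sq_mem (zpowers u ⊔ zpowers z) (hnorm ?_ ?_) (hnorm ?_ ?_)
      hzS (hyu ▸ huS))
    · rwa [hcent x hxP, mul_inv_cancel_right]
    · rcases hcomm x hxP u hg with h | h
      · rwa [mul_inv_eq_one.1 h]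
      · rw [mul_inv_eq_iff_eq_mul.1 h]
        exact mul_mem hzS huS
    · have h0 : y * z * y⁻¹ = g * (x * (g⁻¹ * z * g) * x⁻¹) * g⁻¹ := by simp [hy, mul_assoc]
      rw [h0]
      rcases hcomm x hxP _ hwP with h | h
      · rw [mul_inv_eq_one.1 h]
        simpa [mul_assoc] using hzS
      · rw [mul_inv_eq_iff_eq_mul.1 h]
        convert mul_mem huS hzS using 1
        simp [hu, mul_assoc]
    · have : Commute y u := hyu ▸ Commute.self_pow y 2
      rwa [this.eq, mul_inv_cancel_right]
  rcases hsq y hyP with h | h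
  · rw [hyu, hu, conj_eq_one_iff] at h
    exact absurd h hx2
  · rw [← hyu, h]

theorem focalSubgroup_le_zpowers (hC : ∀ g, Commute g (x ^ 2) → g ∈ P) (hx : orderOf x = 4)
    (hsq : ∀ a ∈ P, a ^ 2 = 1 ∨ a ^ 2 = x ^ 2)
    (hcomm : ∀ a ∈ P, ∀ b ∈ P, a * b * a⁻¹ * b⁻¹ = 1 ∨ a * b * a⁻¹ * b⁻¹ = x ^ 2)
    (hmul : ∀ a ∈ P, ∀ b ∈ P, a ∉ zpowers x → b ∉ zpowers x → a * b ∈ zpowers x)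
    (hweak : ∀ g, g * x ^ 2 * g⁻¹ ∈ P → g * x ^ 2 * g⁻¹ = x ^ 2) :
    focalSubgroup P ≤ zpowers x := by
  have hx2 : x ^ 2 ∈ zpowers x := pow_mem (mem_zpowers x) 2
  have hx4 : (x ^ 2) ^ 2 = 1 := by
    rw [← pow_mul]
    exact orderOf_dvd_iff_pow_eq_one.1 hx.dvd
  have hx1 : x ^ 2 ≠ 1 := fun h ↦ by
    have := Nat.le_of_dvd (by norm_num) (orderOf_dvd_of_pow_eq_one h)
    omega
  have hinv {a : G} (ha : a ∈ zpowers x) (ha2 : a ^ 2 = 1) : a = 1 ∨ a = x ^ 2 := by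
    obtain ⟨k, rfl⟩ := mem_zpowers_iff.1 ha
    rcases Int.even_or_odd' k with ⟨m, rfl | rfl⟩
    · rw [zpow_mul]
      norm_cast
      rcases Int.even_or_odd' m with ⟨l, rfl | rfl⟩
      · left
        rw [zpow_mul]
        norm_cast
        rw [hx4, one_zpow]
      · right
        rw [zpow_add, zpow_mul]
        norm_cast
        rw [hx4, one_zpow, one_mul, pow_one]
    · rw [← zpow_natCast, ← zpow_mul, mul_comm, zpow_mul, zpow_add, zpow_mul] at ha2
      norm_cast at ha2
      rw [hx4, one_zpow, one_mul, pow_one] at ha2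
      exact absurd ha2 hx1
  rw [focalSubgroup_def, closure_le]
  rintro c ⟨hcP, p, hp, g, rfl⟩
  rw [commutatorElement_def] at hcP ⊢
  have hq : g * p * g⁻¹ ∈ P := by
    have := mul_mem (inv_mem hcP) hp
    simpa [mul_assoc] using this
  have hcom : p * g * p⁻¹ * g⁻¹ = p * (g * p * g⁻¹)⁻¹ := by simp [mul_assoc]
  rw [SetLike.mem_coe]
  rcases hsq p hp with h1 | h1
  · by_cases hpx : p ∈ zpowers x
    · rw [hcom]
      rcases hinv hpx h1 with rfl | rfl
      · simp
      · simp [hweak g hq]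
    · rw [hcom]
      refine hmul _ hp _ (inv_mem hq) hpx fun h ↦ hpx ?_
      rw [inv_mem_iff] at h
      rcases hinv h (by rw [conj_pow, h1]; simp) with h2 | h2
      · rw [conj_eq_one_iff.1 h2]
        exact one_mem _
      · have h3 : p = g⁻¹ * x ^ 2 * g⁻¹⁻¹ := by rw [← h2]; simp [mul_assoc]
        rw [h3, hweak g⁻¹ (h3 ▸ hp)]
        exact hx2
  · have h2 : g * x ^ 2 * g⁻¹ = x ^ 2 := hweak g (by rw [← h1, ← conj_pow]; exact pow_mem hq 2)
    have hg : g ∈ P := hC g (mul_inv_eq_iff_eq_mul.1 h2)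
    rcases hcomm p hp g hg with h | h
    · rw [h]
      exact one_mem _
    · rw [h]
      exact hx2

end WeakClosure

theorem normalizer_le_centralizer_of_isCyclic {K : Type*} [Group K] [Finite K]
    (hK : 2 ∣ Nat.card K) (P : Sylow 2 K) [IsCyclic P] :
    normalizer (P : Set K) ≤ centralizer (P : Set K) :=
  IsCyclic.normalizer_le_centralizer (p := 2) ((Nat.minFac_eq_two_iff _).2 hK) ‹_›

theorem isSolvable_of_solubilizer_eq_sylow {G : Type*} [Group G] [Finite G] {x : G}
    (hcard : Nat.card (solubilizer x) = 8) (P : Sylow 2 G) (hxP : x ∈ P)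
    (hP : solubilizer x ⊆ P) (hP8 : Nat.card P = 8)
    (hncomm : ¬ ∀ a b : P, a * b = b * a) : Group.IsSolvable G := by
  have := P.2.isNilpotent
  have hPsol : Group.IsSolvable P := inferInstance
  have hC (g : G) (hg : Commute g (x ^ 2)) : g ∈ (P : Subgroup G) := mem_of_commute_sq hP hg
  by_cases hx2 : x ^ 2 = 1
  · have htop : (⊤ : Subgroup G) ≤ P := fun g _ ↦ hC g (by rw [hx2]; exact Commute.one_right g)
    exact Group.isSolvable_of_surjective (f := (P : Subgroup G).subtype)
      fun g ↦ ⟨⟨g, htop (mem_top g)⟩, rfl⟩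
  have hx : orderOf x = 4 := by
    have h8 : orderOf x ≠ 8 := fun h ↦ hncomm fun c d ↦ by
      have := isCyclic_of_orderOf_eq_card (⟨x, hxP⟩ : P) ((orderOf_mk x hxP).trans (h.trans hP8.symm))
      have := IsCyclic.isMulCommutative (α := P)
      exact mul_comm' c d
    have hdvd : orderOf x ∣ 2 ^ 3 := by simpa [hcard] using orderOf_dvd_card_solubilizer x
    have h2 := mt orderOf_dvd_iff_pow_eq_one.1 hx2
    obtain ⟨k, hk, hxk⟩ := (Nat.dvd_prime_pow Nat.prime_two).1 hdvd
    interval_cases k <;> simp_all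
  obtain ⟨hcent, hsq, hcomm, hmul⟩ := relations_of_card_eq_eight hP8 hncomm
    (x := ⟨x, hxP⟩) (by rwa [orderOf_mk])
  simp only [Subtype.forall, Subtype.ext_iff, coe_mul, coe_pow, coe_inv, coe_one] at hcent hsq hcomm
  have hweak (g : G) : g * x ^ 2 * g⁻¹ ∈ (P : Subgroup G) → g * x ^ 2 * g⁻¹ = x ^ 2 :=
    conj_sq_eq_of_mem hxP hP hC hx2 hcent hsq hcomm
  have hz (a : P) : a ∈ zpowers (⟨x, hxP⟩ : P) ↔ (a : G) ∈ zpowers x := by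
    simp [mem_zpowers_iff, Subtype.ext_iff]
  have hfocal := focalSubgroup_le_zpowers hC hx hsq hcomm
    (fun a ha b hb h1 h2 ↦ (hz _).1 (hmul ⟨a, ha⟩ ⟨b, hb⟩ (mt (hz _).1 h1) (mt (hz _).1 h2))) hweak
  rw [← commutator_inf_eq_focalSubgroup] at hfocal
  have hx1 : x ≠ 1 := by rintro rfl; simp at hx
  have hx4 : orderOf x = 2 ^ 2 := hx
  have hK : Group.IsSolvable (commutator G) := by
    by_cases heven : 2 ∣ Nat.card (commutator G)
    · obtain ⟨Q⟩ : Nonempty (Sylow 2 (commutator G)) := inferInstance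
      obtain ⟨R, hR⟩ := Q.exists_comap_subtype_eq
      obtain ⟨g, hg⟩ := MulAction.exists_smul_eq G R P
      have hmem (q : Q) : g * q * g⁻¹ ∈ zpowers x := by
        refine hfocal ⟨Normal.conj_mem inferInstance _ q.1.2 g, ?_⟩
        rw [← hg]
        have hqR : ((q : commutator G) : G) ∈ (R : Subgroup G) := by
          have : (q : commutator G) ∈ (Q : Subgroup (commutator G)) := q.2
          rw [← hR] at this
          exact this
        exact ⟨_, hqR, rfl⟩
      let f : Q →* zpowers x :=
        (((MulAut.conj g).toMonoidHom.comp (commutator G).subtype).comp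
          (Q : Subgroup (commutator G)).subtype).codRestrict _ hmem
      have hf : Function.Injective f := fun a b hab ↦ by
        have := congrArg Subtype.val hab
        simpa [f] using this
      have : IsCyclic Q := isCyclic_of_injective f hf
      have hr : (commutator G).subtype.range.Normal := by
        rw [range_subtype]
        infer_instance
      exact isSolvable_of_normalizer_le_centralizer hx4 hx1 hcard (commutator G).subtype
        (subtype_injective _) Q (normalizer_le_centralizer_of_isCyclic heven Q)
    · exact isSolvable_of_odd_normal hx4 hx1 hcard (commutator G)
        (Nat.not_even_iff_odd.1 (mt even_iff_two_dvd.1 heven))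
  exact Group.isSolvable_of_ker_le_range (commutator G).subtype (Abelianization.of (G := G))
    (by simp [Abelianization.ker_of])

theorem mul_comm_of_card_eq_two_pow {Q : Type*} [Group Q] {k : ℕ} (hQ : Nat.card Q = 2 ^ k)
    (hk : k ≤ 2) (a b : Q) : a * b = b * a := by
  have := Nat.finite_of_card_ne_zero (hQ.trans_ne (by positivity))
  obtain rfl | hk : k = 2 ∨ k ≤ 1 := by omega
  · have := IsPGroup.isMulCommutative_of_card_eq_prime_sq hQ
    exact mul_comm' a b
  · have : IsCyclic Q := isCyclic_of_card_dvd_prime (p := 2) (by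
      rw [hQ]
      exact pow_dvd_pow 2 hk)
    have := IsCyclic.isMulCommutative (α := Q)
    exact mul_comm' a b

theorem sylow_normalizer_le_of_card_le {G : Type*} [Group G] [Finite G] {P : Sylow 2 G}
    (h : Nat.card (normalizer (P : Set G)) < 3 * Nat.card P) : normalizer (P : Set G) ≤ P := by
  have hle : (P : Subgroup G) ≤ normalizer (P : Set G) := le_normalizer
  have hodd : ¬ 2 ∣ (P : Subgroup G).relIndex (normalizer (P : Set G)) := fun h2 ↦
    P.not_dvd_index (h2.trans (relIndex_dvd_index_of_le hle))
  have hmul : _ * (P : Subgroup G).relIndex _ = _ :=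
    ((P : Subgroup G).subgroupOf (normalizer (P : Set G))).card_mul_index
  rw [Nat.card_congr (subgroupOfEquivOfLe hle).toEquiv] at hmul
  rw [← hmul, mul_comm] at h
  have := lt_of_mul_lt_mul_right h (Nat.zero_le _)
  exact relIndex_eq_one.1 (by omega)

end

theorem stmt_10 {G : Type*} [Group G] [Finite G] (hG : ¬ IsSolvable G)
    (x : G) : Nat.card (solubilizer x) ≠ 8 := by
  intro hcard
  apply hG
  change Group.IsSolvable G
  have hdvd : orderOf x ∣ 2 ^ 3 := by simpa [hcard] using orderOf_dvd_card_solubilizer x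
  obtain ⟨n, -, hn⟩ := (Nat.dvd_prime_pow Nat.prime_two).1 hdvd
  have hpg : IsPGroup 2 (Subgroup.zpowers x) :=
    IsPGroup.of_card (n := n) (by rw [Nat.card_zpowers, hn])
  obtain ⟨P, hPx⟩ := hpg.exists_le_sylow
  have hxP : x ∈ (P : Subgroup G) := hPx (Subgroup.mem_zpowers x)
  have := P.2.isNilpotent
  have hP8 := hcard ▸ card_le_card_solubilizer (P : Subgroup G) hxP
  obtain ⟨k, hk⟩ := P.2.exists_card_eq
  by_cases hx1 : x = 1
  · subst hx1
    have htop : solubilizer (1 : G) = Set.univ := Set.eq_univ_of_forall fun y ↦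
      mem_solubilizer_of_mem (Subgroup.zpowers y) (one_mem _) (Subgroup.mem_zpowers y)
    rw [htop, Nat.card_univ] at hcard
    have := (IsPGroup.of_card (p := 2) (n := 3) hcard).isNilpotent
    infer_instance
  have hk3 : k ≤ 3 := (Nat.pow_le_pow_iff_right one_lt_two).1 (hk ▸ hP8 : 2 ^ k ≤ 2 ^ 3)
  by_cases hcomm : ∀ a b : P, a * b = b * a
  · have hr : (MonoidHom.id G).range.Normal := by
      rw [MonoidHom.range_eq_top.2 Function.surjective_id]
      infer_instance
    refine isSolvable_of_normalizer_le_centralizer hn hx1 hcard (MonoidHom.id G)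
      Function.injective_id P ?_
    by_cases h2 : k ≤ 1
    · have : IsCyclic P := isCyclic_of_card_dvd_prime (p := 2) (hk ▸ pow_dvd_pow 2 h2)
      refine normalizer_le_centralizer_of_isCyclic ?_ P
      have hn0 : n ≠ 0 := by
        rintro rfl
        exact hx1 (orderOf_eq_one_iff.1 hn)
      exact (dvd_pow_self 2 hn0).trans (hn ▸ orderOf_dvd_natCard x)
    · have hN : Nat.card (Subgroup.normalizer (P : Set G)) ≤ 8 := by
        rw [← hcard]
        exact Nat.card_mono (Set.toFinite _) fun g hg ↦
          have := isSolvable_zpowers_sup (P : Subgroup G) hg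
          mem_solubilizer_of_mem (Subgroup.zpowers g ⊔ P)
            (le_sup_right (a := Subgroup.zpowers g) hxP)
            (le_sup_left (a := Subgroup.zpowers g) (Subgroup.mem_zpowers g))
      have h4 : 2 ^ 2 ≤ Nat.card P := hk ▸ Nat.pow_le_pow_right two_pos (by omega)
      intro g hg
      rw [Subgroup.mem_centralizer_iff]
      intro a ha
      exact congrArg Subtype.val
        (hcomm ⟨a, ha⟩ ⟨g, sylow_normalizer_le_of_card_le (by omega) hg⟩)
  · obtain rfl : k = 3 := by
      by_contra h
      exact hcomm (mul_comm_of_card_eq_two_pow hk (by omega))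
    refine isSolvable_of_solubilizer_eq_sylow hcard P hxP (Eq.ge ?_) hk hcomm
    refine Set.eq_of_subset_of_ncard_le (fun y hy ↦ mem_solubilizer_of_mem P hxP hy) ?_
    rw [← Nat.card_coe_set_eq, hcard]
    exact hk.ge
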